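/- Let p₁ and p₂ be distinct primes and k = p₁p₂. Then for every nonempty finite set A of integers, |A + k·A| ≥ (k+1)|A| − k!. -/

import Mathlib

open Finset Pointwise

/-- The dilate `k·B`. -/
def dl (k : ℕ) (B : Finset ℤ) : Finset ℤ := B.image (fun b => (k : ℤ) * b)

/-- The part of `A` in the residue class `x` mod `k`. -/
def cl (k : ℕ) (A : Finset ℤ) (x : ZMod k) : Finset ℤ := A.filter (fun a : ℤ => (a : ZMod k) = x)

/-- The set of residues of `A` mod `k`. -/
def rs (k : ℕ) (A : Finset ℤ) : Finset (ZMod k) := A.image (fun a : ℤ => (a : ZMod k))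

/-- Invariance of a set of residues under a shift. -/
def ShInv {k : ℕ} (S : Finset (ZMod k)) (g : ZMod k) : Prop := ∀ x ∈ S, x + g ∈ S

lemma mem_cl {k : ℕ} {A : Finset ℤ} {x : ZMod k} {a : ℤ} :
    a ∈ cl k A x ↔ a ∈ A ∧ (a : ZMod k) = x := by simp [cl]

lemma mem_rs {k : ℕ} {A : Finset ℤ} {x : ZMod k} :
    x ∈ rs k A ↔ ∃ a ∈ A, (a : ZMod k) = x := by simp [rs]

lemma mem_dl {k : ℕ} {A : Finset ℤ} {x : ℤ} :
    x ∈ dl k A ↔ ∃ a ∈ A, (k : ℤ) * a = x := by simp [dl]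

lemma card_dl {k : ℕ} (hk : 0 < k) (A : Finset ℤ) : (dl k A).card = A.card := by
  apply card_image_of_injective
  intro a b h
  have : (k : ℤ) ≠ 0 := by exact_mod_cast hk.ne'
  exact mul_left_cancel₀ this h

lemma dl_mono {k : ℕ} {A B : Finset ℤ} (h : A ⊆ B) : dl k A ⊆ dl k B := image_subset_image h

lemma cl_nonempty {k : ℕ} {A : Finset ℤ} {x : ZMod k} (h : x ∈ rs k A) : (cl k A x).Nonempty := by
  obtain ⟨a, ha, hx⟩ := mem_rs.1 h
  exact ⟨a, mem_cl.2 ⟨ha, hx⟩⟩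

lemma sum_cl {k : ℕ} (A : Finset ℤ) : ∑ x ∈ rs k A, (cl k A x).card = A.card := by
  unfold rs cl
  exact (card_eq_sum_card_image (fun a : ℤ => (a : ZMod k)) A).symm

lemma card_add_ge (X T : Finset ℤ) (hX : X.Nonempty) (hT : T.Nonempty) :
    X.card + T.card ≤ (X + T).card + 1 := by
  have := cauchy_davenport_add_of_linearOrder_isCancelAdd hX hT
  omega

/-- Sum over classes when the second summand lies in one class. -/
lemma L1 {k : ℕ} (X T : Finset ℤ) (t : ZMod k) (hT : T.Nonempty)
    (ht : ∀ b ∈ T, (b : ZMod k) = t) :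
    X.card + (rs k X).card * (T.card - 1) ≤ (X + T).card := by
  have h1 : ∑ x ∈ rs k X, (cl k X x + T).card ≤ (X + T).card := by
    rw [← card_biUnion]
    · apply card_le_card
      intro y hy
      simp only [mem_biUnion] at hy
      obtain ⟨x, -, hy⟩ := hy
      exact add_subset_add_right (filter_subset _ _) hy
    · intro x _ y _ hxy
      change Disjoint (cl k X x + T) (cl k X y + T)
      rw [disjoint_left]
      intro z hz hz'
      obtain ⟨a, ha, b, hb, rfl⟩ := mem_add.1 hz
      obtain ⟨a', ha', b', hb', h⟩ := mem_add.1 hz'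
      have := congrArg (Int.cast : ℤ → ZMod k) h
      push_cast at this
      rw [ht _ hb, ht _ hb', (mem_cl.1 ha).2, (mem_cl.1 ha').2] at this
      exact hxy (add_right_cancel this).symm
  have h2 : ∑ x ∈ rs k X, ((cl k X x).card + (T.card - 1)) ≤ ∑ x ∈ rs k X, (cl k X x + T).card := by
    apply sum_le_sum
    intro x hx
    have := card_add_ge _ T (cl_nonempty hx) hT
    have := hT.card_pos
    omega
  rw [sum_add_distrib, sum_cl, sum_const, smul_eq_mul] at h2
  omega

/-- The gain from another class. -/
lemma L2 {k : ℕ} (X A T U : Finset ℤ) (t u : ZMod k) (hTA : T ⊆ A) (hUA : U ⊆ A)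
    (ht : ∀ b ∈ T, (b : ZMod k) = t) (hu : ∀ b ∈ U, (b : ZMod k) = u) :
    (X + U).card + ((rs k X).image (· + t) \ (rs k X).image (· + u)).card * T.card
      ≤ (X + A).card := by
  set Y := (rs k X).image (· + t) \ (rs k X).image (· + u) with hY
  set W := (X + T).filter (fun a : ℤ => (a : ZMod k) ∈ Y) with hW
  have h1 : Y.card * T.card ≤ W.card := by
    rw [card_eq_sum_card_fiberwise (f := fun a : ℤ => (a : ZMod k)) (t := Y) (s := W)]
    · rw [← smul_eq_mul]
      apply card_nsmul_le_sum
      intro y hy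
      have hy' := hy
      rw [hY, mem_sdiff, mem_image] at hy'
      obtain ⟨⟨x, hx, rfl⟩, -⟩ := hy'
      obtain ⟨a, ha, rfl⟩ := mem_rs.1 hx
      rw [← card_image_of_injective T (add_right_injective a)]
      apply card_le_card
      intro z hz
      obtain ⟨b, hb, rfl⟩ := mem_image.1 hz
      have e : ((a + b : ℤ) : ZMod k) = (a : ZMod k) + t := by push_cast; rw [ht _ hb]
      simp only [hW, mem_filter]
      rw [e]
      exact ⟨⟨add_mem_add ha hb, hy⟩, rfl⟩
    · intro a ha
      simp only [hW, coe_filter, Set.mem_ofPred_eq] at ha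
      exact ha.2
  have h2 : Disjoint (X + U) W := by
    rw [disjoint_left]
    intro z hz hz'
    obtain ⟨a, ha, b, hb, rfl⟩ := mem_add.1 hz
    have h3 := (mem_filter.1 hz').2
    rw [hY, mem_sdiff] at h3
    apply h3.2
    push_cast
    rw [hu _ hb]
    exact mem_image.2 ⟨_, mem_rs.2 ⟨a, ha, rfl⟩, rfl⟩
  have h3 : (X + U) ∪ W ⊆ X + A :=
    union_subset (add_subset_add_left hUA) ((filter_subset _ _).trans (add_subset_add_left hTA))
  have := card_le_card h3
  rw [card_union_of_disjoint h2] at this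
  omega

lemma ShInv.mul {k : ℕ} [NeZero k] {S : Finset (ZMod k)} {g : ZMod k} (h : ShInv S g) (z : ZMod k) :
    ShInv S (z * g) := by
  have : ∀ n : ℕ, ShInv S (n * g) := by
    intro n
    induction n with
    | zero => intro x hx; simpa using hx
    | succ n ih =>
      intro x hx
      have := h _ (ih x hx)
      convert this using 1
      push_cast
      ring
  have h2 := this z.val
  rwa [ZMod.natCast_zmod_val] at h2

lemma ShInv.card_le {p q k : ℕ} (hk : k = p * q) (hq : 0 < q) {S : Finset (ZMod k)}
    (hS : S.Nonempty) (h : ShInv S (q : ZMod k)) [NeZero k] : p ≤ S.card := by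
  obtain ⟨x, hx⟩ := hS
  have h1 : ((range p).image (fun n : ℕ => x + (n : ZMod k) * q)) ⊆ S := by
    intro y hy
    obtain ⟨n, -, rfl⟩ := mem_image.1 hy
    exact h.mul _ x hx
  have h2 := card_le_card h1
  rwa [card_image_of_injOn, card_range] at h2
  intro n hn m hm hnm
  simp only [coe_range, Set.mem_Iio] at hn hm
  have h3 : ((n * q : ℕ) : ZMod k) = ((m * q : ℕ) : ZMod k) := by
    push_cast
    exact add_left_cancel hnm
  rw [ZMod.natCast_eq_natCast_iff, hk] at h3
  have h4 := Nat.ModEq.mul_right_cancel' hq.ne' h3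
  exact Nat.ModEq.eq_of_lt_of_lt h4 hn hm

lemma ShInv.of_row {p q k : ℕ} (hk : k = p * q) (hp : p.Prime) [NeZero k] {S : Finset (ZMod k)}
    {d : ZMod k} (hd : (q : ZMod k) * d ≠ 0) (h : ShInv S d) : ShInv S (q : ZMod k) := by
  have hpq : (p : ZMod k) * q = 0 := by
    rw [← Nat.cast_mul, ← hk, ZMod.natCast_self]
  have hnd : ¬ p ∣ d.val := by
    rintro ⟨e, he⟩
    apply hd
    rw [← ZMod.natCast_zmod_val d, he]
    push_cast
    linear_combination (e : ZMod k) * hpq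
  have hc : IsCoprime (p : ℤ) (d.val : ℤ) :=
    Nat.isCoprime_iff_coprime.2 ((Nat.Prime.coprime_iff_not_dvd hp).2 hnd)
  obtain ⟨a, b, hab⟩ := hc
  have h2 := congrArg (Int.cast : ℤ → ZMod k) hab
  push_cast at h2
  rw [ZMod.natCast_zmod_val] at h2
  have := h.mul (q * b)
  convert this using 1
  linear_combination (-(q : ZMod k)) * h2 + (a : ZMod k) * hpq

lemma ShInv.full {p q k : ℕ} (hc : p.Coprime q) [NeZero k] {S : Finset (ZMod k)} (hS : S.Nonempty)
    (h1 : ShInv S (p : ZMod k)) (h2 : ShInv S (q : ZMod k)) : S.card = k := by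
  obtain ⟨a, b, hab⟩ := Nat.isCoprime_iff_coprime.2 hc
  have h3 := congrArg (Int.cast : ℤ → ZMod k) hab
  push_cast at h3
  obtain ⟨x, hx⟩ := hS
  have : S = univ := by
    rw [eq_univ_iff_forall]
    intro y
    have h4 := h2.mul ((y - x) * b) _ (h1.mul ((y - x) * a) x hx)
    convert h4 using 1
    linear_combination (x - y) * h3
  rw [this, card_univ, ZMod.card]

lemma gain_pos {k : ℕ} {S : Finset (ZMod k)} {t u : ZMod k} (h : ¬ ShInv S (t - u)) :
    (S.image (· + t) \ S.image (· + u)).Nonempty := by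
  unfold ShInv at h
  push Not at h
  obtain ⟨x, hx, hn⟩ := h
  refine ⟨x + t, mem_sdiff.2 ⟨mem_image_of_mem _ hx, ?_⟩⟩
  intro hm
  obtain ⟨y, hy, e⟩ := mem_image.1 hm
  apply hn
  have : x + (t - u) = y := by linear_combination -e
  rwa [this]

lemma gain_inv {k : ℕ} [NeZero k] {S : Finset (ZMod k)} {t u g : ZMod k} (h : ShInv S g) :
    ShInv (S.image (· + t) \ S.image (· + u)) g := by
  intro y hy
  rw [mem_sdiff] at hy ⊢
  obtain ⟨hy1, hy2⟩ := hy
  obtain ⟨x, hx, rfl⟩ := mem_image.1 hy1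
  refine ⟨mem_image.2 ⟨x + g, h x hx, by ring⟩, ?_⟩
  intro hm
  obtain ⟨s, hs, e⟩ := mem_image.1 hm
  apply hy2
  refine mem_image.2 ⟨s + (-1) * g, h.mul (-1) s hs, ?_⟩
  linear_combination e

/-- All the facts about a class that are used in the counting. -/
lemma cls {p q k : ℕ} (hk : k = p * q) (hp : p.Prime) (hq : q.Prime) (hne : p ≠ q)
    (A : Finset ℤ) (i : ZMod k) (hi : i ∈ rs k A) :
    ∃ α β : Prop,
      (α → ∀ t ∈ rs k A, (cl k A i).card + p * ((cl k A t).card - 1)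
          ≤ (cl k A i + dl k A).card) ∧
      (β → ∀ t ∈ rs k A, (cl k A i).card + q * ((cl k A t).card - 1)
          ≤ (cl k A i + dl k A).card) ∧
      (α → β → ∀ t ∈ rs k A, (cl k A i).card + k * ((cl k A t).card - 1)
          ≤ (cl k A i + dl k A).card) ∧
      (¬ α → ∀ t ∈ rs k A, (q : ZMod k) * (t - i) ≠ 0 →
        (cl k A i + dl k (cl k A i)).card + (cl k A t).card ≤ (cl k A i + dl k A).card) ∧
      (¬ β → ∀ t ∈ rs k A, (p : ZMod k) * (t - i) ≠ 0 →
        (cl k A i + dl k (cl k A i)).card + (cl k A t).card ≤ (cl k A i + dl k A).card) ∧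
      (¬ α → β → ∀ t ∈ rs k A, (q : ZMod k) * (t - i) ≠ 0 →
        (cl k A i + dl k (cl k A i)).card + q * (cl k A t).card ≤ (cl k A i + dl k A).card) ∧
      (α → ¬ β → ∀ t ∈ rs k A, (p : ZMod k) * (t - i) ≠ 0 →
        (cl k A i + dl k (cl k A i)).card + p * (cl k A t).card ≤ (cl k A i + dl k A).card) := by
  have hk0 : 0 < k := by rw [hk]; exact Nat.mul_pos hp.pos hq.pos
  have : NeZero k := ⟨hk0.ne'⟩
  have hk' : k = q * p := by rw [hk, mul_comm]
  have hkz : (k : ℤ) ≠ 0 := by exact_mod_cast hk0.ne'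
  obtain ⟨a0, ha0, hai⟩ := mem_rs.1 hi
  -- the rescaled class
  set X : Finset ℤ := (cl k A i).image (fun a => (a - a0) / k) with hX
  have hdiv : ∀ a ∈ cl k A i, a = a0 + k * ((a - a0) / k) := by
    intro a ha
    have h1 : (k : ℤ) ∣ a - a0 := by
      rw [← ZMod.intCast_zmod_eq_zero_iff_dvd]
      push_cast
      rw [(mem_cl.1 ha).2, hai, sub_self]
    rw [Int.mul_ediv_cancel' h1]
    ring
  have hAX : cl k A i = X.image (fun x => a0 + k * x) := by
    rw [hX, image_image]
    ext a
    simp only [mem_image, Function.comp]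
    constructor
    · intro ha
      exact ⟨a, ha, (hdiv a ha).symm⟩
    · rintro ⟨b, hb, rfl⟩
      rwa [← hdiv b hb]
  have hinj : Function.Injective (fun x : ℤ => a0 + k * x) := by
    intro x y h
    exact mul_left_cancel₀ hkz (add_left_cancel h)
  have hcX : (cl k A i).card = X.card := by rw [hAX, card_image_of_injective _ hinj]
  have hsum : ∀ B : Finset ℤ, (cl k A i + dl k B).card = (X + B).card := by
    intro B
    rw [← card_image_of_injective (X + B) hinj]
    congr 1
    ext z
    rw [hAX]
    simp only [mem_add, mem_image, mem_dl]
    constructor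
    · rintro ⟨_, ⟨x, hx, rfl⟩, _, ⟨b, hb, rfl⟩, rfl⟩
      exact ⟨x + b, ⟨x, hx, b, hb, rfl⟩, by ring⟩
    · rintro ⟨_, ⟨x, hx, b, hb, rfl⟩, rfl⟩
      exact ⟨_, ⟨x, hx, rfl⟩, _, ⟨b, hb, rfl⟩, by ring⟩
  have hXne : X.Nonempty := (cl_nonempty hi).image _
  set S := rs k X with hS
  have hSne : S.Nonempty := hXne.image _
  have H1 : ∀ t ∈ rs k A, ∀ m ≤ S.card, (cl k A i).card + m * ((cl k A t).card - 1)
          ≤ (cl k A i + dl k A).card := by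
    intro t ht m hm
    have h1 := L1 X (cl k A t) t (cl_nonempty ht) (fun b hb => (mem_cl.1 hb).2)
    have h2 : (X + cl k A t).card ≤ (X + A).card :=
      card_le_card (add_subset_add_left (filter_subset _ _))
    rw [← hS] at h1
    have h3 := Nat.mul_le_mul_right ((cl k A t).card - 1) hm
    rw [hsum, hcX]
    omega
  have H2 : ∀ t ∈ rs k A, ∀ m ≤ (S.image (· + t) \ S.image (· + i)).card,
      (cl k A i + dl k (cl k A i)).card + m * (cl k A t).card ≤ (cl k A i + dl k A).card := by
    intro t ht m hm
    have h1 := L2 X A (cl k A t) (cl k A i) t i (filter_subset _ _) (filter_subset _ _)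
      (fun b hb => (mem_cl.1 hb).2) (fun b hb => (mem_cl.1 hb).2)
    rw [← hS] at h1
    have h3 := Nat.mul_le_mul_right ((cl k A t).card) hm
    rw [hsum, hsum]
    omega
  have hcop : q.Coprime p := (Nat.coprime_primes hq hp).2 hne.symm
  refine ⟨ShInv S (q : ZMod k), ShInv S (p : ZMod k), ?_, ?_, ?_, ?_, ?_, ?_, ?_⟩
  · intro h t ht
    exact H1 t ht p (h.card_le hk hq.pos hSne)
  · intro h t ht
    exact H1 t ht q (h.card_le hk' hp.pos hSne)
  · intro h h' t ht
    exact H1 t ht k (ShInv.full hcop hSne h h').ge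
  · intro h t ht hd
    have := H2 t ht 1 (gain_pos (fun h' => h (h'.of_row hk hp hd))).card_pos
    rwa [one_mul] at this
  · intro h t ht hd
    have := H2 t ht 1 (gain_pos (fun h' => h (h'.of_row hk' hq hd))).card_pos
    rwa [one_mul] at this
  · intro h h' t ht hd
    exact H2 t ht q ((gain_inv h').card_le hk' hp.pos
      (gain_pos (fun h' => h (h'.of_row hk hp hd))))
  · intro h' h t ht hd
    exact H2 t ht p ((gain_inv h').card_le hk hq.pos
      (gain_pos (fun h' => h (h'.of_row hk' hq hd))))

lemma sum_N {k : ℕ} (A : Finset ℤ) :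
    ∑ i ∈ rs k A, (cl k A i + dl k A).card ≤ (A + dl k A).card := by
  rw [← card_biUnion]
  · apply card_le_card
    intro y hy
    simp only [mem_biUnion] at hy
    obtain ⟨x, -, hy⟩ := hy
    exact add_subset_add_right (filter_subset _ _) hy
  · intro x _ y _ hxy
    change Disjoint (cl k A x + dl k A) (cl k A y + dl k A)
    have key : ∀ u z, z ∈ cl k A u + dl k A → (z : ZMod k) = u := by
      intro u z hz
      obtain ⟨a, ha, b, hb, rfl⟩ := mem_add.1 hz
      obtain ⟨c, -, rfl⟩ := mem_dl.1 hb
      push_cast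
      rw [(mem_cl.1 ha).2, ZMod.natCast_self]
      ring
    rw [disjoint_left]
    intro z hz hz'
    exact hxy ((key x z hz).symm.trans (key y z hz'))

/-- The inductive statement. -/
def PP (k j : ℕ) : Prop := ∀ A : Finset ℤ, A.Nonempty →
  (j + 1) * A.card ≤ (A + dl k A).card + j.factorial

lemma notI {p q k : ℕ} (hk : k = p * q) (hp : p.Prime) (hq : q.Prime) (hne : p ≠ q)
    (m : ℕ) (hm : m + 2 ≤ k) (hP : PP k m) (A : Finset ℤ) (i₁ : ZMod k) (hi₁ : i₁ ∈ rs k A)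
    (hM : ∀ t ∈ rs k A, (q : ZMod k) * (t - i₁) ≠ 0 →
      q * (cl k A t).card + m.factorial < (cl k A i₁).card)
    (R : Finset ℤ) (hR : R = A.filter (fun a : ℤ => (q : ZMod k) * ((a : ZMod k) - i₁) = 0))
    (hIH : (m + 2 + 1) * R.card ≤ (R + dl k R).card + (m + 2).factorial) :
    (m + 2 + 1) * A.card ≤ (A + dl k A).card + (m + 2).factorial := by
  have hD : ∀ i ∈ rs k A, (q : ZMod k) * (i - i₁) ≠ 0 →
      (m + 2 + 1) * (cl k A i).card ≤ (cl k A i + dl k A).card := by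
    intro i hi hd
    have h1 := hM i hi hd
    obtain ⟨α, β, f1, -, -, g1, -⟩ := cls hk hp hq hne A i hi
    by_cases ha : α
    · have h2 := f1 ha i₁ hi₁
      have h3 : q * (cl k A i).card ≤ (cl k A i₁).card - 1 := by omega
      have h4 := Nat.mul_le_mul_left p h3
      rw [← mul_assoc, ← hk] at h4
      have h5 := Nat.mul_le_mul_right (cl k A i).card hm
      have h6 : (m + 2 + 1) * (cl k A i).card = (m + 2) * (cl k A i).card + (cl k A i).card := by
        ring
      omega
    · have hd' : (q : ZMod k) * (i₁ - i) ≠ 0 := by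
        intro h
        apply hd
        linear_combination -h
      have h2 := g1 ha i₁ hi₁ hd'
      have h3 := hP _ (cl_nonempty hi)
      have h4 := Nat.mul_le_mul_right (cl k A i).card hq.two_le
      have h6 : (m + 2 + 1) * (cl k A i).card
        = (m + 1) * (cl k A i).card + 2 * (cl k A i).card := by ring
      omega
  have hN := sum_N (k := k) A
  have hA := sum_cl (k := k) A
  rw [← sum_filter_add_sum_filter_not _ (fun i => (q : ZMod k) * (i - i₁) = 0)] at hN hA
  have h1 : (m + 2 + 1) * ∑ i ∈ rs k A with ¬ (q : ZMod k) * (i - i₁) = 0, (cl k A i).card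
      ≤ ∑ i ∈ rs k A with ¬ (q : ZMod k) * (i - i₁) = 0, (cl k A i + dl k A).card := by
    rw [mul_sum]
    apply sum_le_sum
    intro i hi
    rw [mem_filter] at hi
    exact hD i hi.1 hi.2
  have h2 : (R + dl k R).card
      ≤ ∑ i ∈ rs k A with (q : ZMod k) * (i - i₁) = 0, (cl k A i + dl k A).card := by
    refine le_trans (card_le_card ?_) card_biUnion_le
    intro z hz
    obtain ⟨a, ha, b, hb, rfl⟩ := mem_add.1 hz
    rw [hR, mem_filter] at ha
    rw [mem_biUnion]
    refine ⟨(a : ZMod k), mem_filter.2 ⟨mem_rs.2 ⟨a, ha.1, rfl⟩, ha.2⟩, ?_⟩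
    refine add_mem_add (mem_cl.2 ⟨ha.1, rfl⟩) (dl_mono ?_ hb)
    rw [hR]
    exact filter_subset _ _
  have h3 : ∑ i ∈ rs k A with (q : ZMod k) * (i - i₁) = 0, (cl k A i).card ≤ R.card := by
    rw [← card_biUnion]
    · apply card_le_card
      intro a ha
      rw [mem_biUnion] at ha
      obtain ⟨i, hi, ha⟩ := ha
      rw [mem_filter] at hi
      rw [mem_cl] at ha
      rw [hR, mem_filter, ha.2]
      exact ⟨ha.1, hi.2⟩
    · intro x _ y _ hxy
      change Disjoint (cl k A x) (cl k A y)
      rw [disjoint_left]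
      intro z hz hz'
      exact hxy ((mem_cl.1 hz).2.symm.trans (mem_cl.1 hz').2)
  have h4 := Nat.mul_le_mul_left (m + 2 + 1) h3
  rw [← hA, mul_add]
  omega

lemma caseI {p q k : ℕ} (hk : k = p * q) (hp : p.Prime) (hq : q.Prime) (hne : p ≠ q)
    (m : ℕ) (hm : m + 2 ≤ k) (hP : PP k (m + 1)) (A : Finset ℤ)
    (hc : (rs k A).card ≤ m + 1) (i₁ : ZMod k) (hi₁ : i₁ ∈ rs k A)
    (hmax : ∀ t ∈ rs k A, (cl k A t).card ≤ (cl k A i₁).card)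
    (t : ZMod k) (ht : t ∈ rs k A) (htr : (q : ZMod k) * (t - i₁) ≠ 0)
    (hta : (cl k A i₁).card ≤ q * (cl k A t).card + m.factorial)
    (t' : ZMod k) (ht' : t' ∈ rs k A) (htr' : (p : ZMod k) * (t' - i₁) ≠ 0)
    (hta' : (cl k A i₁).card ≤ p * (cl k A t').card + m.factorial) :
    (m + 2 + 1) * A.card ≤ (A + dl k A).card + (m + 2).factorial := by
  have key : ∀ i ∈ rs k A, (m + 2) * (cl k A i).card + (cl k A (Equiv.swap i₁ t i)).card
      ≤ (cl k A i + dl k A).card + ((m + 1).factorial + m.factorial) := by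
    intro i hi
    obtain ⟨α, β, -, -, f, g1, g1', g2, g2'⟩ := cls hk hp hq hne A i hi
    have hB := hP _ (cl_nonempty hi)
    have hsw : Equiv.swap i₁ t i ∈ rs k A := by
      rw [Equiv.swap_apply_def]
      split_ifs <;> assumption
    have hs := hmax _ hsw
    have hai := hmax i hi
    have strong : (cl k A i + dl k (cl k A i)).card + (cl k A i₁).card
        ≤ (cl k A i + dl k A).card + m.factorial →
        (m + 2) * (cl k A i).card + (cl k A (Equiv.swap i₁ t i)).card
      ≤ (cl k A i + dl k A).card + ((m + 1).factorial + m.factorial) := by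
      intro h
      have : (m + 1 + 1) * (cl k A i).card = (m + 2) * (cl k A i).card := by ring
      omega
    by_cases ha : α <;> by_cases hb : β
    · -- full class
      have h1 := f ha hb i₁ hi₁
      have hpos := (cl_nonempty hi₁).card_pos
      obtain ⟨w, hw⟩ : ∃ w, (cl k A i₁).card = w + 1 := ⟨_, (Nat.succ_pred_eq_of_pos hpos).symm⟩
      have h2 : (m + 2) * w ≤ k * w := Nat.mul_le_mul_right w hm
      have h3 : m + 2 ≤ (m + 1).factorial + m.factorial := by
        have : (m + 1).factorial + m.factorial = (m + 2) * m.factorial := by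
          rw [Nat.factorial_succ]; ring
        rw [this]
        exact Nat.le_mul_of_pos_right _ (Nat.factorial_pos m)
      rw [hw] at h1 hs hai
      have h4 : w + 1 - 1 = w := rfl
      rw [h4] at h1
      have h5 : (m + 1) * (cl k A i).card ≤ (m + 1) * (w + 1) := Nat.mul_le_mul_left _ hai
      nlinarith
    · apply strong
      by_cases hd : (p : ZMod k) * (i₁ - i) = 0
      · have : (p : ZMod k) * (t' - i) ≠ 0 := by
          intro h
          apply htr'
          linear_combination h - hd
        have := g2' ha hb t' ht' this
        omega
      · have := g1' hb i₁ hi₁ hd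
        omega
    · apply strong
      by_cases hd : (q : ZMod k) * (i₁ - i) = 0
      · have : (q : ZMod k) * (t - i) ≠ 0 := by
          intro h
          apply htr
          linear_combination h - hd
        have := g2 ha hb t ht this
        omega
      · have := g1 ha i₁ hi₁ hd
        omega
    · by_cases hii : i = i₁
      · subst hii
        rw [Equiv.swap_apply_left]
        have := g1 ha t ht htr
        have h7 : (m + 1 + 1) * (cl k A i).card = (m + 2) * (cl k A i).card := by ring
        omega
      · apply strong
        by_cases hd : (q : ZMod k) * (i₁ - i) = 0
        · have hd' : (p : ZMod k) * (i₁ - i) ≠ 0 := by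
            intro hd'
            obtain ⟨a, b, hab⟩ :=
              Nat.isCoprime_iff_coprime.2 ((Nat.coprime_primes hp hq).2 hne)
            have h3 := congrArg (Int.cast : ℤ → ZMod k) hab
            push_cast at h3
            apply hii
            linear_combination (i₁ - i) * h3 - (a : ZMod k) * hd' - (b : ZMod k) * hd
          have := g1' hb i₁ hi₁ hd'
          omega
        · have := g1 ha i₁ hi₁ hd
          omega
  have hN := sum_N (k := k) A
  have hA := sum_cl (k := k) A
  have hsum := sum_le_sum key
  rw [sum_add_distrib, sum_add_distrib, ← mul_sum, hA, sum_const, smul_eq_mul] at hsum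
  have hsw : ∑ i ∈ rs k A, (cl k A (Equiv.swap i₁ t i)).card = A.card := by
    rw [← hA]
    refine sum_equiv (Equiv.swap i₁ t) ?_ (fun _ _ => rfl)
    intro i
    rw [Equiv.swap_apply_def]
    split_ifs with h1 h2
    · subst h1; simp [hi₁, ht]
    · subst h2; simp [hi₁, ht]
    · rfl
  rw [hsw] at hsum
  have h1 := Nat.mul_le_mul_right ((m + 1).factorial + m.factorial) hc
  have h2 : (m + 1) * ((m + 1).factorial + m.factorial) = (m + 2).factorial := by
    rw [Nat.factorial_succ (m + 1), Nat.factorial_succ m]; ring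
  have h3 : (m + 2 + 1) * A.card = (m + 2) * A.card + A.card := by ring
  omega

/-- The induction measure. -/
def mu (A : Finset ℤ) : ℕ := ∑ a ∈ A, ∑ b ∈ A, (a - b).natAbs

lemma mu_lt {R A : Finset ℤ} (h : R ⊆ A) {r d : ℤ} (hr : r ∈ R) (hd : d ∈ A) (hd' : d ∉ R) :
    mu R < mu A := by
  unfold mu
  calc ∑ a ∈ R, ∑ b ∈ R, (a - b).natAbs < ∑ a ∈ R, ∑ b ∈ A, (a - b).natAbs := by
        apply sum_lt_sum
        · intro a _
          exact sum_le_sum_of_subset h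
        · refine ⟨r, hr, ?_⟩
          refine sum_lt_sum_of_subset h hd hd' ?_ (fun _ _ _ => Nat.zero_le _)
          have : r ≠ d := by rintro rfl; exact hd' hr
          omega
    _ ≤ _ := sum_le_sum_of_subset h

lemma scale {k p : ℕ} (hp : 2 ≤ p) (A : Finset ℤ) (a₀ : ℤ) (ha₀ : a₀ ∈ A)
    (hA : 1 < A.card) (h : ∀ a ∈ A, (p : ℤ) ∣ a - a₀) :
    ∃ A' : Finset ℤ, A'.Nonempty ∧ A'.card = A.card ∧
      (A' + dl k A').card = (A + dl k A).card ∧ mu A' < mu A := by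
  have hpz : (p : ℤ) ≠ 0 := by positivity
  obtain ⟨A', rfl⟩ : ∃ A' : Finset ℤ, A = A'.image (fun x => a₀ + p * x) := by
    refine ⟨A.image (fun a => (a - a₀) / p), ?_⟩
    rw [image_image]
    have : ∀ a ∈ A, a₀ + p * ((a - a₀) / p) = a := by
      intro a ha
      rw [Int.mul_ediv_cancel' (h a ha)]
      ring
    ext a
    simp only [mem_image, Function.comp]
    constructor
    · intro ha
      exact ⟨a, ha, this a ha⟩
    · rintro ⟨b, hb, rfl⟩
      rwa [this b hb]
  have hinj : Function.Injective (fun x : ℤ => a₀ + p * x) := by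
    intro x y h
    exact mul_left_cancel₀ hpz (add_left_cancel h)
  have hinj2 : Function.Injective (fun x : ℤ => a₀ + k * a₀ + p * x) := by
    intro x y h
    exact mul_left_cancel₀ hpz (add_left_cancel h)
  rw [card_image_of_injective _ hinj] at hA ⊢
  refine ⟨A', card_pos.1 (by omega), rfl, ?_, ?_⟩
  · rw [← card_image_of_injective (A' + dl k A') hinj2]
    congr 1
    ext z
    simp only [mem_add, mem_image, mem_dl]
    constructor
    · rintro ⟨_, ⟨x, hx, _, ⟨b, hb, rfl⟩, rfl⟩, rfl⟩
      exact ⟨_, ⟨x, hx, rfl⟩, _, ⟨_, ⟨b, hb, rfl⟩, rfl⟩, by ring⟩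
    · rintro ⟨_, ⟨x, hx, rfl⟩, _, ⟨_, ⟨b, hb, rfl⟩, rfl⟩, rfl⟩
      exact ⟨_, ⟨x, hx, _, ⟨b, hb, rfl⟩, rfl⟩, by ring⟩
  · have e : mu (A'.image (fun x => a₀ + p * x)) = p * mu A' := by
      unfold mu
      rw [sum_image (fun x _ y _ h => hinj h), mul_sum]
      apply sum_congr rfl
      intro x _
      rw [sum_image (fun x _ y _ h => hinj h), mul_sum]
      apply sum_congr rfl
      intro y _
      rw [show (a₀ + p * x - (a₀ + p * y) : ℤ) = p * (x - y) by ring, Int.natAbs_mul]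
      simp
    rw [e]
    obtain ⟨x, hx, y, hy, hxy⟩ := one_lt_card.1 hA
    have h1 : mu {x} < mu A' :=
      mu_lt (singleton_subset_iff.2 hx) (mem_singleton_self x) hy
        (by rw [mem_singleton]; exact fun h => hxy h.symm)
    nlinarith

lemma dvd_of_row {p q k : ℕ} (hk : k = p * q) (hq : 0 < q) (a b : ℤ)
    (h : (q : ZMod k) * ((a : ZMod k) - b) = 0) : (p : ℤ) ∣ a - b := by
  have h1 : (((q : ℤ) * (a - b) : ℤ) : ZMod k) = 0 := by
    push_cast
    exact h
  rw [ZMod.intCast_zmod_eq_zero_iff_dvd, hk] at h1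
  push_cast at h1
  rw [mul_comm (q : ℤ)] at h1
  exact Int.dvd_of_mul_dvd_mul_right (by exact_mod_cast hq.ne') h1

lemma step {p q k : ℕ} (hk : k = p * q) (hp : p.Prime) (hq : q.Prime) (hne : p ≠ q)
    (m : ℕ) (hm : m + 2 ≤ k) (hP0 : PP k m) (hP1 : PP k (m + 1)) : PP k (m + 2) := by
  have hk0 : 0 < k := by omega
  have hk' : k = q * p := by rw [hk, mul_comm]
  suffices H : ∀ n, ∀ A : Finset ℤ, mu A = n → A.Nonempty →
      (m + 2 + 1) * A.card ≤ (A + dl k A).card + (m + 2).factorial from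
    fun A hA => H _ A rfl hA
  intro n
  induction n using Nat.strong_induction_on with
  | _ n ih =>
  intro A hn hA
  subst hn
  by_cases h1 : A.card = 1
  · have h2 := Nat.self_le_factorial (m + 2)
    have h3 : 0 < (A + dl k A).card := (hA.add (hA.image _)).card_pos
    rw [h1]
    omega
  have hA1 : 1 < A.card := by
    have := hA.card_pos
    omega
  by_cases hc : m + 2 ≤ (rs k A).card
  · have h2 := L1 (k := k) A (dl k A) 0 (hA.image _) (by
      intro b hb
      obtain ⟨a, -, rfl⟩ := mem_dl.1 hb
      push_cast
      rw [ZMod.natCast_self, zero_mul])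
    rw [card_dl hk0] at h2
    have h3 := Nat.mul_le_mul_right (A.card - 1) hc
    have h4 := Nat.self_le_factorial (m + 2)
    obtain ⟨w, hw⟩ : ∃ w, A.card = w + 1 := ⟨A.card - 1, by omega⟩
    rw [hw] at h2 h3 ⊢
    simp only [Nat.add_sub_cancel] at h2 h3
    nlinarith
  have hrs : (rs k A).Nonempty := hA.image _
  obtain ⟨i₁, hi₁, hmax⟩ := exists_max_image (rs k A) (fun t => (cl k A t).card) hrs
  obtain ⟨a₁, ha₁, rfl⟩ := mem_rs.1 hi₁
  -- two general reductions
  have row : ∀ p q : ℕ, k = p * q → p.Prime → q.Prime → p ≠ q →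
      (∃ t ∈ rs k A, (q : ZMod k) * (t - a₁) ≠ 0 ∧
        (cl k A a₁).card ≤ q * (cl k A t).card + m.factorial) ∨
      (m + 2 + 1) * A.card ≤ (A + dl k A).card + (m + 2).factorial := by
    intro p q hk hp hq hne
    by_cases hall : ∀ a ∈ A, (q : ZMod k) * ((a : ZMod k) - a₁) = 0
    · right
      obtain ⟨A', h1, h2, h3, h4⟩ := scale (k := k) hp.two_le A a₁ ha₁ hA1
        (fun a ha => dvd_of_row hk hq.pos a a₁ (hall a ha))
      have := ih _ h4 A' rfl h1
      rwa [h2, h3] at this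
    · by_cases hM : ∀ t ∈ rs k A, (q : ZMod k) * (t - a₁) ≠ 0 →
        q * (cl k A t).card + m.factorial < (cl k A a₁).card
      · right
        push Not at hall
        obtain ⟨d, hd, hd'⟩ := hall
        set R := A.filter (fun a : ℤ => (q : ZMod k) * ((a : ZMod k) - a₁) = 0) with hR
        have ha₁R : a₁ ∈ R := by
          rw [hR, mem_filter]
          exact ⟨ha₁, by ring⟩
        have hdR : d ∉ R := by
          rw [hR, mem_filter]
          exact fun h => hd' h.2
        exact notI hk hp hq hne m hm hP0 A a₁ hi₁ hM R hR
          (ih _ (mu_lt (filter_subset _ _) ha₁R hd hdR) R rfl ⟨a₁, ha₁R⟩)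
      · left
        push Not at hM
        exact hM
  rcases row p q hk hp hq hne with ⟨t, ht, htr, hta⟩ | h
  · rcases row q p hk' hq hp hne.symm with ⟨t', ht', htr', hta'⟩ | h
    · exact caseI hk hp hq hne m hm hP1 A (by omega) a₁ hi₁ hmax t ht htr hta t' ht' htr' hta'
    · exact h
  · exact h

lemma all_PP {p q k : ℕ} (hk : k = p * q) (hp : p.Prime) (hq : q.Prime) (hne : p ≠ q) :
    ∀ j, (j ≤ k → PP k j) ∧ (j + 1 ≤ k → PP k (j + 1)) := by
  have hk0 : 0 < k := by rw [hk]; exact Nat.mul_pos hp.pos hq.pos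
  have base : ∀ A : Finset ℤ, A.Nonempty → 2 * A.card ≤ (A + dl k A).card + 1 := by
    intro A hA
    have := card_add_ge A (dl k A) hA (hA.image _)
    rw [card_dl hk0] at this
    omega
  intro j
  induction j with
  | zero =>
    constructor
    · intro _ A hA
      have := base A hA
      have := hA.card_pos
      simp only [Nat.factorial_zero]
      omega
    · intro _ A hA
      have := base A hA
      simp only [zero_add, Nat.factorial_one]
      omega
  | succ j ih =>
    refine ⟨ih.2, fun h => ?_⟩
    exact step hk hp hq hne j h (ih.1 (by omega)) (ih.2 (by omega))

/-- Let `p₁`, `p₂` be distinct primes and `k = p₁p₂`. Then for every nonempty finite set `A`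
of integers, `|A + k·A| ≥ (k+1)|A| − k!`. -/
theorem stmt_14 (p₁ p₂ : ℕ) (hp₁ : p₁.Prime) (hp₂ : p₂.Prime) (hne : p₁ ≠ p₂)
    (k : ℕ) (hk : k = p₁ * p₂)
    (A : Finset ℤ) (hA : A.Nonempty) :
    ((k : ℤ) + 1) * A.card - (Nat.factorial k : ℤ) ≤
      ((A + A.image (fun b => (k : ℤ) * b)).card : ℤ) := by
  have h := ((all_PP hk hp₁ hp₂ hne k).1 le_rfl) A hA
  unfold dl at h
  zify at h
  linarith
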